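/- Let M ≥ 1 be an integer, Σ an M×M Hermitian positive-definite complex matrix, λ ∈ (0,1), and r̃ ∈ ℂ^M (a column vector). Define ψ_a(g) = exp(−r̃*(Σ^{−1} − (Σ + g^{−2}Σ²)^{−1})r̃)/(g^{γ}·det(Σ + g²I)), ψ_b(g) = exp(−r̃*(g^{−2}I − (g²I + g⁴Σ^{−1})^{−1})r̃)/(g^{γ}·det(Σ + g²I)), and ψ_c = ((1−λ)/(a·λ))·exp(−r̃*Σ^{−1}r̃)/det Σ. Then the Bayes posterior mean for the prior (1−λ)δ₀ + λ·q_M under noise with density φ_Σ satisfies (λ·∫_{ℂ^M} r·q_M(r)·φ_Σ(r̃−r) dr) / ((1−λ)·φ_Σ(r̃) + λ·∫_{ℂ^M} q_M(r)·φ_Σ(r̃−r) dr) = (∫₀^∞ Q(g)·ψ_a(g)·(g^{−2}Σ + I)^{−1} r̃ dg) / (ψ_c + ∫₀^∞ Q(g)·ψ_b(g) dg). -/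

import Mathlib

open MeasureTheory Set
open scoped ENNReal

noncomputable section

/-- `Q(g) = ∫_{b ln g + c}^∞ exp(-s²) ds`. -/
def Qfun (b c g : ℝ) : ℝ := ∫ s in Set.Ioi (b * Real.log g + c), Real.exp (-s ^ 2)

/-- Squared Euclidean norm on `ℂ^M ≅ ℝ^{2M}`. -/
def nsq {M : ℕ} (r : Fin M → ℂ) : ℝ := ∑ i, ‖r i‖ ^ 2

/-- Circularly symmetric complex Gaussian density of variance `v` on `ℂ^M ≅ ℝ^{2M}`:
`φ_v^{(M)}(r) = (πv)^{-M} exp(-‖r‖²/v)`. -/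
def vgauss (M : ℕ) (v : ℝ) (r : Fin M → ℂ) : ℝ :=
  ((Real.pi * v) ^ M)⁻¹ * Real.exp (-nsq r / v)

/-- Channel-row density `q_M(r) = a π^{-M} ∫₀^∞ g^{-γ-2M} Q(g) exp(-‖r‖²/g²) dg`. -/
def qM (a γ b c : ℝ) (M : ℕ) (r : Fin M → ℂ) : ℝ :=
  a / Real.pi ^ M *
    ∫ g in Set.Ioi (0 : ℝ), g ^ (-γ - 2 * (M : ℝ)) * Qfun b c g * Real.exp (-nsq r / g ^ 2)

open scoped ComplexOrder

open Matrix in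
/-- Circularly symmetric complex Gaussian density with covariance `S` on `ℂ^M`. -/
def mgauss (M : ℕ) (S : Matrix (Fin M) (Fin M) ℂ) (u : Fin M → ℂ) : ℝ :=
  (Real.pi ^ M * S.det.re)⁻¹ * Real.exp (-((star u) ⬝ᵥ (S⁻¹ *ᵥ u)).re)

section ShadowingTail

lemma integrable_exp_neg_sq : Integrable (fun s : ℝ => Real.exp (-s ^ 2)) := by
  simpa using integrable_exp_neg_mul_sq (b := 1) one_pos

lemma integrable_exp_mul_sub_sq (k : ℝ) :
    Integrable (fun s : ℝ => Real.exp (k * s - s ^ 2)) := by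
  refine ((integrable_exp_neg_sq.comp_sub_right (k / 2)).const_mul
    (Real.exp (k ^ 2 / 4))).congr (ae_of_all _ fun s => ?_)
  simp only [← Real.exp_add]
  ring_nf

lemma Qfun_nonneg (b c g : ℝ) : 0 ≤ Qfun b c g :=
  integral_nonneg fun _ => (Real.exp_pos _).le

lemma measurable_Qfun (b c : ℝ) : Measurable (Qfun b c) := by
  have h : Antitone fun x : ℝ => ∫ s in Ioi x, Real.exp (-s ^ 2) := fun x y hxy =>
    setIntegral_mono_set integrable_exp_neg_sq.integrableOn
      (ae_of_all _ fun _ => (Real.exp_pos _).le) (Ioi_subset_Ioi hxy).eventuallyLE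
  exact h.measurable.comp ((Real.measurable_log.const_mul b).add_const c)

/-- Gaussian tails decay faster than any exponential. -/
lemma exists_Qfun_le (b c : ℝ) {k : ℝ} (hk : 0 ≤ k) :
    ∃ C, ∀ g, 0 < g → Qfun b c g ≤ C * g ^ (-(k * b)) := by
  refine ⟨(∫ s, Real.exp (k * s - s ^ 2)) * Real.exp (-(k * c)), fun g hg => ?_⟩
  have h1 : Qfun b c g ≤ ∫ s in Ioi (b * Real.log g + c),
      Real.exp (-(k * (b * Real.log g + c))) * Real.exp (k * s - s ^ 2) := by
    refine setIntegral_mono_on integrable_exp_neg_sq.integrableOn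
      ((integrable_exp_mul_sub_sq k).const_mul _).integrableOn measurableSet_Ioi fun s hs => ?_
    rw [← Real.exp_add]
    have := mul_le_mul_of_nonneg_left (mem_Ioi.mp hs).le hk
    exact Real.exp_le_exp.mpr (by linarith)
  refine h1.trans ?_
  rw [integral_const_mul]
  have h2 : ∫ s in Ioi (b * Real.log g + c), Real.exp (k * s - s ^ 2) ≤
      ∫ s, Real.exp (k * s - s ^ 2) :=
    setIntegral_le_integral (integrable_exp_mul_sub_sq k) (ae_of_all _ fun _ => (Real.exp_pos _).le)
  refine (mul_le_mul_of_nonneg_left h2 (Real.exp_pos _).le).trans (le_of_eq ?_)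
  rw [Real.rpow_def_of_pos hg, mul_assoc, ← Real.exp_add, mul_comm]
  ring_nf

lemma integrableOn_rpow_mul_Qfun {γ b : ℝ} (hγ : 1 < γ) (hb : b < 0) (c : ℝ) :
    IntegrableOn (fun g => g ^ (-γ) * Qfun b c g) (Ioi 0) := by
  have hm : Measurable fun g : ℝ => g ^ (-γ) * Qfun b c g :=
    (measurable_id.pow_const _).mul (measurable_Qfun b c)
  rw [← Ioc_union_Ioi_eq_Ioi zero_le_one, integrableOn_union]
  constructor
  · obtain ⟨C, hC⟩ := exists_Qfun_le b c (k := γ / (-b)) (div_nonneg (by linarith) (by linarith))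
    have hkb : -(γ / (-b) * b) = γ := by rw [div_neg, neg_mul, neg_neg, div_mul_cancel₀ _ hb.ne]
    rw [hkb] at hC
    refine Integrable.mono' (g := fun _ => C) (integrableOn_const (by simp))
      hm.aestronglyMeasurable ?_
    filter_upwards [ae_restrict_mem measurableSet_Ioc] with g hg
    have h0 := Real.rpow_pos_of_pos hg.1 (-γ)
    rw [Real.norm_of_nonneg (mul_nonneg h0.le (Qfun_nonneg _ _ _))]
    refine (mul_le_mul_of_nonneg_left (hC g hg.1) h0.le).trans (le_of_eq ?_)
    rw [mul_left_comm, ← Real.rpow_add hg.1]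
    simp
  · obtain ⟨C, hC⟩ := exists_Qfun_le b c le_rfl
    refine Integrable.mono' (g := fun g => C * g ^ (-γ))
      ((integrableOn_Ioi_rpow_of_lt (by linarith) one_pos).const_mul C)
      hm.aestronglyMeasurable ?_
    filter_upwards [ae_restrict_mem measurableSet_Ioi] with g hg
    have hg0 : 0 < g := one_pos.trans hg
    have h0 := Real.rpow_pos_of_pos hg0 (-γ)
    rw [Real.norm_of_nonneg (mul_nonneg h0.le (Qfun_nonneg _ _ _)), mul_comm]
    refine mul_le_mul_of_nonneg_right ?_ h0.le
    simpa using hC g hg0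

end ShadowingTail

section IsotropicGaussian

variable {M : ℕ}

lemma nsq_nonneg (r : Fin M → ℂ) : 0 ≤ nsq r := Finset.sum_nonneg fun _ _ => sq_nonneg _

lemma continuous_nsq : Continuous (nsq : (Fin M → ℂ) → ℝ) := by
  unfold nsq; fun_prop

lemma norm_sq_le_nsq (r : Fin M → ℂ) : ‖r‖ ^ 2 ≤ nsq r := by
  have h : ‖r‖ ≤ √(nsq r) := (pi_norm_le_iff_of_nonneg (Real.sqrt_nonneg _)).mpr fun i =>
    Real.le_sqrt_of_sq_le (Finset.single_le_sum (f := fun i => ‖r i‖ ^ 2)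
      (fun _ _ => sq_nonneg _) (Finset.mem_univ i))
  exact (pow_le_pow_left₀ (norm_nonneg _) h 2).trans_eq (Real.sq_sqrt (nsq_nonneg r))

lemma exp_neg_nsq_div (v : ℝ) (r : Fin M → ℂ) :
    Real.exp (-nsq r / v) = ∏ i, Real.exp (-v⁻¹ * ‖r i‖ ^ 2) := by
  rw [← Real.exp_sum, ← Finset.mul_sum]
  congr 1
  unfold nsq
  ring

lemma integral_exp_neg_nsq_div {v : ℝ} (hv : 0 < v) :
    ∫ r : Fin M → ℂ, Real.exp (-nsq r / v) = (Real.pi * v) ^ M := by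
  simp_rw [exp_neg_nsq_div]
  rw [integral_fintype_prod_volume_eq_prod (fun _ (z : ℂ) => Real.exp (-v⁻¹ * ‖z‖ ^ 2))]
  rw [GaussianFourier.integral_rexp_neg_mul_sq_norm (inv_pos.mpr hv)]
  simp [Complex.finrank_real_complex]

lemma vgauss_nonneg {v : ℝ} (hv : 0 < v) (r : Fin M → ℂ) : 0 ≤ vgauss M v r := by
  unfold vgauss; positivity

lemma integral_vgauss {v : ℝ} (hv : 0 < v) : ∫ r : Fin M → ℂ, vgauss M v r = 1 := by
  unfold vgauss
  rw [integral_const_mul, integral_exp_neg_nsq_div hv]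
  exact inv_mul_cancel₀ (by positivity)

lemma integrable_vgauss {v : ℝ} (hv : 0 < v) : Integrable (vgauss M v) :=
  Integrable.of_integral_ne_zero (by rw [integral_vgauss hv]; exact one_ne_zero)

lemma qM_eq (a γ b c : ℝ) (r : Fin M → ℂ) :
    qM a γ b c M r =
      a * ∫ g in Ioi (0 : ℝ), g ^ (-γ) * Qfun b c g * vgauss M (g ^ 2) r := by
  unfold qM
  rw [div_eq_mul_inv, mul_assoc, ← integral_const_mul]
  congr 1
  refine setIntegral_congr_fun measurableSet_Ioi fun g hg => ?_
  have hg : 0 < g := hg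
  simp only [vgauss]
  rw [sub_eq_add_neg, Real.rpow_add hg, Real.rpow_neg hg.le (2 * (M : ℝ)),
    Real.rpow_mul hg.le, Real.rpow_natCast, Real.rpow_ofNat, mul_pow, mul_inv]
  ring

/-- Fubini for scale mixtures of isotropic Gaussians against a bounded continuous function. -/
lemma integral_mixture_smul {E : Type*} [NormedAddCommGroup E] [NormedSpace ℝ E] [CompleteSpace E]
    [SecondCountableTopology E] [MeasurableSpace E] [BorelSpace E]
    {G : ℝ → ℝ} (hG : IntegrableOn G (Ioi 0)) {F : (Fin M → ℂ) → E}
    (hF : Continuous F) {C : ℝ} (hC : ∀ r, ‖F r‖ ≤ C) :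
    ∫ r, (∫ g in Ioi (0 : ℝ), G g * vgauss M (g ^ 2) r) • F r =
      ∫ g in Ioi (0 : ℝ), G g • ∫ r, vgauss M (g ^ 2) r • F r := by
  have hvm : Measurable fun p : ℝ × (Fin M → ℂ) => vgauss M (p.1 ^ 2) p.2 := by
    have := (continuous_nsq (M := M)).measurable
    unfold vgauss
    fun_prop
  have h1 : Integrable (fun p : ℝ × (Fin M → ℂ) => G p.1 * vgauss M (p.1 ^ 2) p.2)
      ((volume.restrict (Ioi 0)).prod volume) := by
    have hm : AEStronglyMeasurable (fun p : ℝ × (Fin M → ℂ) => G p.1 * vgauss M (p.1 ^ 2) p.2)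
        ((volume.restrict (Ioi 0)).prod volume) :=
      (hG.aestronglyMeasurable.comp_fst).mul
      hvm.aestronglyMeasurable
    rw [integrable_prod_iff hm]
    constructor
    · filter_upwards [ae_restrict_mem measurableSet_Ioi] with g hg
      exact (integrable_vgauss (pow_pos hg 2)).const_mul _
    · refine hG.norm.congr ?_
      filter_upwards [ae_restrict_mem measurableSet_Ioi] with g hg
      have hv : (0 : ℝ) < g ^ 2 := pow_pos hg 2
      simp only [norm_mul, Real.norm_of_nonneg (vgauss_nonneg hv _)]
      rw [integral_const_mul, integral_vgauss hv, mul_one]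
  have h2 : Integrable (fun p : (Fin M → ℂ) × ℝ => (G p.2 * vgauss M (p.2 ^ 2) p.1) • F p.1)
      (volume.prod (volume.restrict (Ioi 0))) :=
    (h1.smul_bdd C (hF.comp continuous_snd).aestronglyMeasurable
      (ae_of_all _ fun p => hC p.2)).swap
  simp_rw [← integral_smul_const]
  refine (integral_integral_swap h2).trans (integral_congr_ae (ae_of_all _ fun g => ?_))
  simp only [mul_smul, integral_smul]

end IsotropicGaussian

section MatrixGaussian

open Matrix

variable {M : ℕ}

open scoped MatrixOrder Matrix.Norms.L2Operator in
lemma exists_conjTranspose_mul_self_of_posDef {A : Matrix (Fin M) (Fin M) ℂ} (hA : A.PosDef) :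
    ∃ B : Matrix (Fin M) (Fin M) ℂ, IsUnit B.det ∧ A = Bᴴ * B := by
  obtain ⟨B, hB⟩ := CStarAlgebra.nonneg_iff_eq_star_mul_self.mp hA.posSemidef.nonneg
  refine ⟨B, ?_, hB⟩
  have h := hA.det_pos.ne'
  rw [hB, det_mul] at h
  exact isUnit_iff_ne_zero.mpr (right_ne_zero_of_mul h)

lemma ofReal_re_det_of_posDef {A : Matrix (Fin M) (Fin M) ℂ} (hA : A.PosDef) :
    ((A.det.re : ℝ) : ℂ) = A.det :=
  Complex.ext rfl (Complex.lt_def.mp hA.det_pos).2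

lemma re_det_pos_of_posDef {A : Matrix (Fin M) (Fin M) ℂ} (hA : A.PosDef) : 0 < A.det.re :=
  (Complex.lt_def.mp hA.det_pos).1

lemma star_dotProduct_self_eq_nsq (r : Fin M → ℂ) : star r ⬝ᵥ r = (nsq r : ℂ) := by
  simp [dotProduct, nsq, Complex.conj_mul']

lemma re_quadForm_conjTranspose_mul_self (B : Matrix (Fin M) (Fin M) ℂ) (r : Fin M → ℂ) :
    (star r ⬝ᵥ ((Bᴴ * B) *ᵥ r)).re = nsq (B *ᵥ r) := by
  rw [← mulVec_mulVec, dotProduct_mulVec, ← star_mulVec, star_dotProduct_self_eq_nsq,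
    Complex.ofReal_re]

lemma integral_exp_neg_re_quadForm {A : Matrix (Fin M) (Fin M) ℂ} (hA : A.PosDef) :
    ∫ r : Fin M → ℂ, Real.exp (-(star r ⬝ᵥ (A *ᵥ r)).re) = Real.pi ^ M / A.det.re := by
  obtain ⟨B, hB, rfl⟩ := exists_conjTranspose_mul_self_of_posDef hA
  simp_rw [re_quadForm_conjTranspose_mul_self]
  set f : (Fin M → ℂ) →ₗ[ℝ] (Fin M → ℂ) := (toLin' B).restrictScalars ℝ
  have hdet : LinearMap.det f = Complex.normSq B.det := by
    rw [LinearMap.det_restrictScalars, LinearMap.det_toLin', Algebra.norm_complex_apply]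
  have hpos : 0 < Complex.normSq B.det := Complex.normSq_pos.mpr hB.ne_zero
  have hAdet : (Bᴴ * B).det.re = Complex.normSq B.det := by
    rw [det_mul, det_conjTranspose, ← Complex.ofReal_re (Complex.normSq B.det),
      Complex.normSq_eq_conj_mul_self]
    rfl
  have hf : LinearMap.det f ≠ 0 := hdet ▸ hpos.ne'
  have hmap := Measure.map_linearMap_addHaar_eq_smul_addHaar (volume : Measure (Fin M → ℂ)) hf
  have hcont : Continuous fun r : Fin M → ℂ => Real.exp (-nsq r) := by
    have := continuous_nsq (M := M)
    fun_prop
  have h := integral_map (μ := volume) (LinearMap.continuous_of_finiteDimensional f).aemeasurable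
    (f := fun r : Fin M → ℂ => Real.exp (-nsq r)) hcont.aestronglyMeasurable
  have h1 := integral_exp_neg_nsq_div (M := M) one_pos
  simp only [div_one, mul_one] at h1
  rw [hmap, integral_smul_measure, h1] at h
  refine h.symm.trans ?_
  rw [hAdet, hdet, ENNReal.toReal_ofReal (abs_nonneg _), abs_of_pos (inv_pos.mpr hpos),
    smul_eq_mul, div_eq_inv_mul]

lemma exists_norm_sq_le_re_quadForm {A : Matrix (Fin M) (Fin M) ℂ} (hA : A.PosDef) :
    ∃ ε > 0, ∀ r, ε * ‖r‖ ^ 2 ≤ (star r ⬝ᵥ (A *ᵥ r)).re := by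
  obtain ⟨B, hB, rfl⟩ := exists_conjTranspose_mul_self_of_posDef hA
  obtain ⟨K, hK, hle⟩ :=
    (LinearMap.toContinuousLinearMap (toLin' B⁻¹)).isBoundedLinearMap.bound
  refine ⟨(K ^ 2)⁻¹, by positivity, fun r => ?_⟩
  rw [re_quadForm_conjTranspose_mul_self]
  refine le_trans ?_ (norm_sq_le_nsq _)
  have h : ‖r‖ ≤ K * ‖B *ᵥ r‖ := by
    simpa [mulVec_mulVec, nonsing_inv_mul B hB] using hle (B *ᵥ r)
  rw [inv_mul_le_iff₀ (by positivity), ← mul_pow]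
  exact pow_le_pow_left₀ (norm_nonneg _) h 2

lemma continuous_mgauss (S : Matrix (Fin M) (Fin M) ℂ) : Continuous (mgauss M S) := by
  unfold mgauss
  have : Continuous fun u : Fin M → ℂ => star u ⬝ᵥ (S⁻¹ *ᵥ u) :=
    continuous_star.dotProduct (continuous_const.matrix_mulVec continuous_id)
  exact continuous_const.mul (Real.continuous_exp.comp (Complex.continuous_re.comp this).neg)

lemma exists_mgauss_le {S : Matrix (Fin M) (Fin M) ℂ} (hS : S.PosDef) :
    ∃ C, ∀ u, mgauss M S u * (1 + ‖u‖) ≤ C := by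
  obtain ⟨ε, hε, hle⟩ := exists_norm_sq_le_re_quadForm hS.inv
  have hd := re_det_pos_of_posDef hS
  refine ⟨(Real.pi ^ M * S.det.re)⁻¹ * (2 + ε⁻¹), fun u => ?_⟩
  unfold mgauss
  rw [mul_assoc]
  refine mul_le_mul_of_nonneg_left ?_ (by positivity)
  have h1 : 1 + ‖u‖ ≤ (2 + ε⁻¹) * Real.exp (ε * ‖u‖ ^ 2) := by
    have h2 := Real.add_one_le_exp (ε * ‖u‖ ^ 2)
    have h3 : (2 + ε⁻¹) * (ε * ‖u‖ ^ 2 + 1) = 2 * ε * ‖u‖ ^ 2 + 2 + ‖u‖ ^ 2 + ε⁻¹ := by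
      field_simp
      ring
    have h4 := mul_le_mul_of_nonneg_left h2 (show 0 ≤ 2 + ε⁻¹ by positivity)
    have h5 : 0 ≤ 2 * ε * ‖u‖ ^ 2 := by positivity
    have h6 := inv_pos.mpr hε
    nlinarith [sq_nonneg (‖u‖ - 1 / 2)]
  rw [Real.exp_neg, inv_mul_le_iff₀ (Real.exp_pos _), mul_comm]
  exact h1.trans (mul_le_mul_of_nonneg_left (Real.exp_le_exp.mpr (hle u)) (by positivity))

lemma mgauss_nonneg {S : Matrix (Fin M) (Fin M) ℂ} (hS : S.PosDef) (u : Fin M → ℂ) :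
    0 ≤ mgauss M S u := by
  have := re_det_pos_of_posDef hS
  unfold mgauss
  positivity

lemma exists_mgauss_sub_le {S : Matrix (Fin M) (Fin M) ℂ} (hS : S.PosDef) (rt : Fin M → ℂ) :
    ∃ C, ∀ r, ‖mgauss M S (rt - r)‖ ≤ C := by
  obtain ⟨C, hC⟩ := exists_mgauss_le hS
  refine ⟨C, fun r => ?_⟩
  rw [Real.norm_of_nonneg (mgauss_nonneg hS _)]
  exact (le_mul_of_one_le_right (mgauss_nonneg hS _)
    (le_add_of_nonneg_right (norm_nonneg _))).trans (hC (rt - r))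

lemma exists_mgauss_sub_smul_le {S : Matrix (Fin M) (Fin M) ℂ} (hS : S.PosDef)
    (rt : Fin M → ℂ) : ∃ C, ∀ r, ‖mgauss M S (rt - r) • r‖ ≤ C := by
  obtain ⟨C, hC⟩ := exists_mgauss_le hS
  refine ⟨C * (1 + ‖rt‖), fun r => ?_⟩
  have h0 := mgauss_nonneg hS (rt - r)
  rw [norm_smul, Real.norm_of_nonneg h0]
  have h1 : ‖r‖ ≤ ‖rt‖ + ‖rt - r‖ := by simpa using norm_sub_le rt (rt - r)
  have h2 : ‖r‖ ≤ (1 + ‖rt - r‖) * (1 + ‖rt‖) := by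
    nlinarith [mul_nonneg (norm_nonneg (rt - r)) (norm_nonneg rt)]
  calc mgauss M S (rt - r) * ‖r‖ ≤ mgauss M S (rt - r) * ((1 + ‖rt - r‖) * (1 + ‖rt‖)) :=
        mul_le_mul_of_nonneg_left h2 h0
    _ ≤ C * (1 + ‖rt‖) := by
        rw [← mul_assoc]
        exact mul_le_mul_of_nonneg_right (hC _) (by positivity)

variable {S : Matrix (Fin M) (Fin M) ℂ}

lemma posDef_add_sq_smul_one (hS : S.PosDef) {g : ℝ} (hg : 0 < g) :
    (S + (g : ℂ) ^ 2 • 1).PosDef :=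
  hS.add (Matrix.PosDef.one.smul (by exact_mod_cast pow_pos hg 2))

lemma posDef_inv_add_inv_sq_smul_one (hS : S.PosDef) {g : ℝ} (hg : 0 < g) :
    (S⁻¹ + ((g : ℂ) ^ 2)⁻¹ • 1).PosDef :=
  hS.inv.add (Matrix.PosDef.one.smul (by exact_mod_cast inv_pos.mpr (pow_pos hg 2)))

/-- Completing the square in the product of two Gaussian exponents. -/
lemma nsq_div_add_re_quadForm (hS : S.PosDef) {g : ℝ} (hg : 0 < g) (w r : Fin M → ℂ) :
    nsq (r + (g : ℂ) ^ 2 • w) / g ^ 2 +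
        (star (S *ᵥ w - r) ⬝ᵥ (S⁻¹ *ᵥ (S *ᵥ w - r))).re =
      (star r ⬝ᵥ ((S⁻¹ + ((g : ℂ) ^ 2)⁻¹ • 1) *ᵥ r)).re +
        (star w ⬝ᵥ ((S + (g : ℂ) ^ 2 • 1) *ᵥ w)).re := by
  have hdet : IsUnit S.det := (isUnit_iff_isUnit_det S).mp hS.isUnit
  have hg2 : (g : ℂ) ^ 2 ≠ 0 := by exact_mod_cast (pow_pos hg 2).ne'
  have h1 : S⁻¹ *ᵥ (S *ᵥ w) = w := by
    rw [mulVec_mulVec, nonsing_inv_mul S hdet, one_mulVec]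
  have h2 : star (S *ᵥ w) ⬝ᵥ (S⁻¹ *ᵥ r) = star w ⬝ᵥ r := by
    rw [star_mulVec, hS.isHermitian.eq, ← dotProduct_mulVec, mulVec_mulVec,
      mul_nonsing_inv S hdet, one_mulVec]
  have h3 : star (S *ᵥ w) ⬝ᵥ w = star w ⬝ᵥ (S *ᵥ w) := by
    rw [star_mulVec, hS.isHermitian.eq, ← dotProduct_mulVec]
  have h4 : nsq (r + (g : ℂ) ^ 2 • w) / g ^ 2 =
      (((g : ℂ) ^ 2)⁻¹ * (star (r + (g : ℂ) ^ 2 • w) ⬝ᵥ (r + (g : ℂ) ^ 2 • w))).re := by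
    rw [star_dotProduct_self_eq_nsq, div_eq_inv_mul]
    norm_cast
  have hstar : star ((g : ℂ) ^ 2) = (g : ℂ) ^ 2 := by simp
  rw [h4, ← Complex.add_re, ← Complex.add_re]
  congr 1
  simp only [star_add, star_sub, star_smul, hstar, add_mulVec, mulVec_sub, smul_mulVec,
    one_mulVec, dotProduct_add, add_dotProduct, sub_dotProduct, dotProduct_sub, smul_dotProduct,
    dotProduct_smul, h1, h2, h3, smul_eq_mul]
  field_simp
  ring

lemma vgauss_mul_mgauss (hS : S.PosDef) {g : ℝ} (hg : 0 < g) (rt r : Fin M → ℂ) :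
    vgauss M (g ^ 2) (r + (g : ℂ) ^ 2 • ((S + (g : ℂ) ^ 2 • 1)⁻¹ *ᵥ rt)) *
        mgauss M S (rt - (r + (g : ℂ) ^ 2 • ((S + (g : ℂ) ^ 2 • 1)⁻¹ *ᵥ rt))) =
      mgauss M (S + (g : ℂ) ^ 2 • 1) rt *
        ((S⁻¹ + ((g : ℂ) ^ 2)⁻¹ • 1).det.re / Real.pi ^ M *
          Real.exp (-(star r ⬝ᵥ ((S⁻¹ + ((g : ℂ) ^ 2)⁻¹ • 1) *ᵥ r)).re)) := by
  have hT := posDef_add_sq_smul_one hS hg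
  have hA := posDef_inv_add_inv_sq_smul_one hS hg
  have hg2 : (g : ℂ) ^ 2 ≠ 0 := by exact_mod_cast (pow_pos hg 2).ne'
  have hSdet : IsUnit S.det := (isUnit_iff_isUnit_det S).mp hS.isUnit
  have hdet : (S + (g : ℂ) ^ 2 • 1).det.re =
      (S⁻¹ + ((g : ℂ) ^ 2)⁻¹ • 1).det.re * ((g ^ 2) ^ M * S.det.re) := by
    apply Complex.ofReal_injective
    push_cast
    have hsmul : ∀ X : Matrix (Fin M) (Fin M) ℂ, ((g : ℂ) ^ 2) ^ M * X.det =
        ((g : ℂ) ^ 2 • X).det := fun X => by rw [det_smul, Fintype.card_fin]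
    rw [ofReal_re_det_of_posDef hT, ofReal_re_det_of_posDef hA, ofReal_re_det_of_posDef hS,
      mul_left_comm, ← det_mul, add_mul, nonsing_inv_mul S hSdet, hsmul,
      smul_add, smul_mul_assoc, one_mul, smul_smul, mul_inv_cancel₀ hg2, one_smul, add_comm]
  set T := S + (g : ℂ) ^ 2 • (1 : Matrix (Fin M) (Fin M) ℂ) with hTdef
  set w := T⁻¹ *ᵥ rt with hw
  have hrt : rt = T *ᵥ w := by
    rw [hw, mulVec_mulVec, mul_nonsing_inv T ((isUnit_iff_isUnit_det T).mp hT.isUnit), one_mulVec]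
  have hsub : rt - (r + (g : ℂ) ^ 2 • w) = S *ᵥ w - r := by
    rw [hrt, hTdef, add_mulVec, smul_mulVec, one_mulVec]
    abel
  have hq : (star rt ⬝ᵥ (T⁻¹ *ᵥ rt)).re = (star w ⬝ᵥ (T *ᵥ w)).re := by
    rw [← hw, hrt, star_mulVec, hT.isHermitian.eq, ← dotProduct_mulVec]
  have hsq := nsq_div_add_re_quadForm hS hg w r
  rw [← hTdef, ← hq] at hsq
  have hexp : Real.exp (-nsq (r + (g : ℂ) ^ 2 • w) / g ^ 2) *
      Real.exp (-(star (S *ᵥ w - r) ⬝ᵥ (S⁻¹ *ᵥ (S *ᵥ w - r))).re) =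
      Real.exp (-(star rt ⬝ᵥ (T⁻¹ *ᵥ rt)).re) *
        Real.exp (-(star r ⬝ᵥ ((S⁻¹ + ((g : ℂ) ^ 2)⁻¹ • 1) *ᵥ r)).re) := by
    rw [← Real.exp_add, ← Real.exp_add, neg_div]
    congr 1
    linarith
  have hdS := re_det_pos_of_posDef hS
  have hdA := re_det_pos_of_posDef hA
  unfold vgauss mgauss
  rw [hsub, mul_mul_mul_comm, hexp, hdet, mul_pow]
  generalize (S⁻¹ + ((g : ℂ) ^ 2)⁻¹ • 1).det.re = d at hdA ⊢
  field_simp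

lemma integral_vgauss_mul_mgauss (hS : S.PosDef) {g : ℝ} (hg : 0 < g) (rt : Fin M → ℂ) :
    ∫ r, vgauss M (g ^ 2) r * mgauss M S (rt - r) = mgauss M (S + (g : ℂ) ^ 2 • 1) rt := by
  have hA := posDef_inv_add_inv_sq_smul_one hS hg
  have hdA := re_det_pos_of_posDef hA
  rw [← integral_add_right_eq_self _ ((g : ℂ) ^ 2 • ((S + (g : ℂ) ^ 2 • 1)⁻¹ *ᵥ rt))]
  simp_rw [vgauss_mul_mgauss hS hg]
  rw [integral_const_mul, integral_const_mul, integral_exp_neg_re_quadForm hA]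
  generalize (S⁻¹ + ((g : ℂ) ^ 2)⁻¹ • 1).det.re = d at hdA ⊢
  field_simp

lemma integrable_vgauss_smul {E : Type*} [NormedAddCommGroup E] [NormedSpace ℝ E]
    [SecondCountableTopology E] [MeasurableSpace E] [BorelSpace E]
    {v : ℝ} (hv : 0 < v) {F : (Fin M → ℂ) → E}
    (hF : Continuous F) {C : ℝ} (hC : ∀ r, ‖F r‖ ≤ C) :
    Integrable fun r => vgauss M v r • F r :=
  (integrable_vgauss hv).smul_bdd C hF.aestronglyMeasurable (ae_of_all _ hC)

lemma integral_vgauss_smul_mgauss_smul (hS : S.PosDef) {g : ℝ} (hg : 0 < g)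
    (rt : Fin M → ℂ) :
    ∫ r, vgauss M (g ^ 2) r • (mgauss M S (rt - r) • r) =
      mgauss M (S + (g : ℂ) ^ 2 • 1) rt •
        ((g : ℂ) ^ 2 • ((S + (g : ℂ) ^ 2 • 1)⁻¹ *ᵥ rt)) := by
  have hcont : Continuous fun r => mgauss M S (rt - r) :=
    (continuous_mgauss S).comp (continuous_const.sub continuous_id)
  obtain ⟨C₁, hC₁⟩ := exists_mgauss_sub_le hS rt
  obtain ⟨C₂, hC₂⟩ := exists_mgauss_sub_smul_le hS rt
  have hv : (0 : ℝ) < g ^ 2 := pow_pos hg 2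
  have hm := integral_vgauss_mul_mgauss hS hg rt
  have hk := vgauss_mul_mgauss hS hg rt
  set μ := (g : ℂ) ^ 2 • ((S + (g : ℂ) ^ 2 • 1)⁻¹ *ᵥ rt)
  have hi₁ : Integrable fun r => vgauss M (g ^ 2) r * mgauss M S (rt - r) :=
    integrable_vgauss_smul hv hcont hC₁
  have hi₂ := integrable_vgauss_smul hv (hcont.smul continuous_id) hC₂
  have hcentred : ∫ r, (vgauss M (g ^ 2) r * mgauss M S (rt - r)) • (r - μ) = 0 := by
    rw [← integral_add_right_eq_self _ μ]
    simp_rw [hk, add_sub_cancel_right]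
    refine self_eq_neg.mp ?_
    rw [← integral_neg]
    conv_lhs => rw [← integral_neg_eq_self]
    simp [mulVec_neg]
  have hsplit : ∀ r, vgauss M (g ^ 2) r • (mgauss M S (rt - r) • r) =
      (vgauss M (g ^ 2) r * mgauss M S (rt - r)) • (r - μ) +
        (vgauss M (g ^ 2) r * mgauss M S (rt - r)) • μ := fun r => by
    rw [← smul_add, sub_add_cancel, mul_smul]
  have hi₃ : Integrable fun r => (vgauss M (g ^ 2) r * mgauss M S (rt - r)) • (r - μ) := by
    refine (hi₂.sub (hi₁.smul_const μ)).congr (ae_of_all _ fun r => ?_)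
    simp [smul_sub, mul_smul]
  simp_rw [hsplit]
  rw [integral_add hi₃ (hi₁.smul_const μ), hcentred, zero_add, integral_smul_const, hm]

lemma inv_add_inv_sq_smul_sq (hS : S.PosDef) {g : ℝ} (hg : 0 < g) :
    (S + ((g : ℂ) ^ 2)⁻¹ • S ^ 2)⁻¹ = S⁻¹ - (S + (g : ℂ) ^ 2 • 1)⁻¹ := by
  have hT := (isUnit_iff_isUnit_det _).mp (posDef_add_sq_smul_one hS hg).isUnit
  have hSd := (isUnit_iff_isUnit_det _).mp hS.isUnit
  have hg2 : (g : ℂ) ^ 2 ≠ 0 := by exact_mod_cast (pow_pos hg 2).ne'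
  refine inv_eq_right_inv ?_
  have h : S + ((g : ℂ) ^ 2)⁻¹ • S ^ 2 = (((g : ℂ) ^ 2)⁻¹ • S) * (S + (g : ℂ) ^ 2 • 1) := by
    simp [mul_add, smul_smul, hg2, pow_two S, add_comm]
  rw [mul_sub]
  nth_rewrite 2 [h]
  rw [mul_assoc, mul_nonsing_inv _ hT, add_mul, mul_nonsing_inv _ hSd, smul_mul_assoc, pow_two S,
    mul_assoc, mul_nonsing_inv _ hSd]
  simp

lemma inv_sq_smul_one_add_pow_four_smul_inv (hS : S.PosDef) {g : ℝ} (hg : 0 < g) :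
    ((g : ℂ) ^ 2 • 1 + (g : ℂ) ^ 4 • S⁻¹)⁻¹ =
      ((g : ℂ) ^ 2)⁻¹ • (1 : Matrix (Fin M) (Fin M) ℂ) - (S + (g : ℂ) ^ 2 • 1)⁻¹ := by
  have hT := (isUnit_iff_isUnit_det _).mp (posDef_add_sq_smul_one hS hg).isUnit
  have hSd := (isUnit_iff_isUnit_det _).mp hS.isUnit
  have hg2 : (g : ℂ) ^ 2 ≠ 0 := by exact_mod_cast (pow_pos hg 2).ne'
  refine inv_eq_right_inv ?_
  have h : (g : ℂ) ^ 2 • 1 + (g : ℂ) ^ 4 • S⁻¹ =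
      ((g : ℂ) ^ 2 • S⁻¹) * (S + (g : ℂ) ^ 2 • 1) := by
    simp [mul_add, smul_smul, nonsing_inv_mul _ hSd, ← pow_add]
  rw [mul_sub]
  nth_rewrite 2 [h]
  rw [mul_assoc, mul_nonsing_inv _ hT, mul_one, mul_smul_comm, mul_one, smul_add, smul_smul,
    smul_smul, inv_mul_cancel₀ hg2, show (g : ℂ) ^ 4 = g ^ 2 * g ^ 2 by ring,
    inv_mul_cancel_left₀ hg2]
  simp

lemma inv_inv_sq_smul_add_one (hS : S.PosDef) {g : ℝ} (hg : 0 < g) :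
    (((g : ℂ) ^ 2)⁻¹ • S + 1)⁻¹ = (g : ℂ) ^ 2 • (S + (g : ℂ) ^ 2 • 1)⁻¹ := by
  have hT := (isUnit_iff_isUnit_det _).mp (posDef_add_sq_smul_one hS hg).isUnit
  have hg2 : (g : ℂ) ^ 2 ≠ 0 := by exact_mod_cast (pow_pos hg 2).ne'
  refine inv_eq_right_inv ?_
  rw [mul_smul_comm, ← smul_mul_assoc, smul_add, smul_smul, mul_inv_cancel₀ hg2, one_smul,
    mul_nonsing_inv _ hT]

end MatrixGaussian

open Matrix in
/-- the Bayes posterior mean for the prior `(1-λ)δ₀ + λ q_M` under complex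
Gaussian noise of covariance `Σ`, expressed through `ψ_a, ψ_b, ψ_c`. -/
theorem stmt10
    (M : ℕ) (hM : 1 ≤ M)
    (S : Matrix (Fin M) (Fin M) ℂ) (hS : S.PosDef)
    (lam : ℝ) (hlam : lam ∈ Set.Ioo (0 : ℝ) 1)
    (R α β σ : ℝ) (hR : 0 < R) (hβ : 0 < β) (hσ : 0 < σ)
    (γ a b c : ℝ)
    (hγ : γ = 40 / β + 1)
    (ha : a = 40 / (R ^ 2 * β * Real.sqrt Real.pi) *
      Real.exp (2 * (Real.log 10) ^ 2 * σ ^ 2 / β ^ 2 - 2 * (Real.log 10) * α / β))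
    (hb : b = -10 * Real.sqrt 2 / ((Real.log 10) * σ))
    (hc : c = (-α - β * Real.logb 10 R) / (Real.sqrt 2 * σ) - 20 / (β * b))
    (rt : Fin M → ℂ)
    (ψa ψb : ℝ → ℝ) (ψc : ℝ)
    (hψa : ∀ g, ψa g =
      Real.exp (-((star rt) ⬝ᵥ ((S⁻¹ - (S + ((g : ℂ) ^ 2)⁻¹ • S ^ 2)⁻¹) *ᵥ rt)).re) /
        (g ^ γ * ((S + (g : ℂ) ^ 2 • 1).det.re)))
    (hψb : ∀ g, ψb g =
      Real.exp (-((star rt) ⬝ᵥ (((((g : ℂ) ^ 2)⁻¹ • (1 : Matrix (Fin M) (Fin M) ℂ) -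
          ((g : ℂ) ^ 2 • 1 + (g : ℂ) ^ 4 • S⁻¹)⁻¹)) *ᵥ rt)).re) /
        (g ^ γ * ((S + (g : ℂ) ^ 2 • 1).det.re)))
    (hψc : ψc = (1 - lam) / (a * lam) *
      Real.exp (-((star rt) ⬝ᵥ (S⁻¹ *ᵥ rt)).re) / S.det.re) :
    ((1 - lam) * mgauss M S rt +
        lam * ∫ r : Fin M → ℂ, qM a γ b c M r * mgauss M S (rt - r))⁻¹ •
      (lam • ∫ r : Fin M → ℂ, (qM a γ b c M r * mgauss M S (rt - r)) • r) =
    (ψc + ∫ g in Set.Ioi (0 : ℝ), Qfun b c g * ψb g)⁻¹ •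
      ∫ g in Set.Ioi (0 : ℝ),
        (Qfun b c g * ψa g) • ((((g : ℂ) ^ 2)⁻¹ • S + 1)⁻¹ *ᵥ rt) := by
  have hγ1 : 1 < γ := by
    rw [hγ]
    exact lt_add_of_pos_left 1 (by positivity)
  have hlog : 0 < Real.log 10 := Real.log_pos (by norm_num)
  have hb0 : b < 0 := by
    rw [hb]
    exact div_neg_of_neg_of_pos (by rw [neg_mul]; exact neg_neg_of_pos (by positivity))
      (by positivity)
  have ha0 : 0 < a := by
    rw [ha]
    positivity
  obtain ⟨hl0, -⟩ := hlam
  have hG := integrableOn_rpow_mul_Qfun hγ1 hb0 c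
  have hcont : Continuous fun r => mgauss M S (rt - r) :=
    (continuous_mgauss S).comp (continuous_const.sub continuous_id)
  obtain ⟨C₁, hC₁⟩ := exists_mgauss_sub_le hS rt
  obtain ⟨C₂, hC₂⟩ := exists_mgauss_sub_smul_le hS rt
  have hden : ∫ r : Fin M → ℂ, qM a γ b c M r * mgauss M S (rt - r) =
      (a / Real.pi ^ M) * ∫ g in Set.Ioi (0 : ℝ), Qfun b c g * ψb g := by
    have h := integral_mixture_smul hG hcont hC₁
    simp_rw [qM_eq, mul_assoc a]
    rw [integral_const_mul, div_eq_mul_inv, mul_assoc]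
    congr 1
    rw [← integral_const_mul]
    refine h.trans (setIntegral_congr_fun measurableSet_Ioi fun g hg => ?_)
    simp only [smul_eq_mul]
    rw [integral_vgauss_mul_mgauss hS hg, hψb, inv_sq_smul_one_add_pow_four_smul_inv hS hg,
      sub_sub_cancel, mgauss, Real.rpow_neg (le_of_lt hg), mul_inv]
    ring
  have hnum : ∫ r : Fin M → ℂ, (qM a γ b c M r * mgauss M S (rt - r)) • r =
      (a / Real.pi ^ M) • ∫ g in Set.Ioi (0 : ℝ),
        (Qfun b c g * ψa g) • ((((g : ℂ) ^ 2)⁻¹ • S + 1)⁻¹ *ᵥ rt) := by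
    have h := integral_mixture_smul (F := fun r => mgauss M S (rt - r) • r) hG (hcont.smul continuous_id) hC₂
    simp_rw [qM_eq, mul_smul]
    rw [integral_smul, div_eq_mul_inv, mul_smul]
    congr 1
    rw [← integral_smul]
    refine h.trans (setIntegral_congr_fun measurableSet_Ioi fun g hg => ?_)
    rw [integral_vgauss_smul_mgauss_smul hS hg, hψa, inv_add_inv_sq_smul_sq hS hg,
      sub_sub_cancel, mgauss, Real.rpow_neg (le_of_lt hg), mul_inv,
      inv_inv_sq_smul_add_one hS hg, smul_mulVec]
    simp only [smul_smul]
    congr 1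
    ring
  have hK : lam * (a / Real.pi ^ M) ≠ 0 := by positivity
  have hdS := re_det_pos_of_posDef hS
  have hψ : (1 - lam) * mgauss M S rt = lam * (a / Real.pi ^ M) * ψc := by
    rw [hψc, mgauss]
    field_simp
  rw [hden, hnum, hψ, ← mul_assoc, ← mul_add, smul_smul, smul_smul, mul_inv]
  congr 1
  rw [mul_assoc, mul_right_comm, inv_mul_cancel₀ hK, one_mul]
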